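/- arXiv:math/0309199 — 7 statements merged into one kernel-verified Lean document; each statement's English description precedes it below -/
import Mathlib

section
/- Let k, m ≥ 1, let A and B be complex matrices with rows and columns indexed by Fin k × Fin m, and let C be an invertible complex matrix with rows and columns indexed by Fin k × Fin k, such that C₁₂ · A₁₃ · B₂₃ = B₂₃ · A₁₃ · C₁₂ as matrices indexed by Fin k × Fin k × Fin m. Then for every n ≥ 1 the row-to-row transfer matrices with periodic boundary conditions commute: T_n(A) · T_n(B) = T_n(B) · T_n(A). -/
open Matrix

/-- The row-to-row transfer matrix with periodic boundary conditions for a vertex model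
with Boltzmann weight matrix `A` (first factor: auxiliary index in `Fin k`, second
factor: physical index in `Fin m`), on a row of `n` sites.  Here `finRotate n i = i + 1`
(mod `n`). -/
noncomputable def transferMatrix (k m n : ℕ)
    (A : Matrix (Fin k × Fin m) (Fin k × Fin m) ℂ) :
    Matrix (Fin n → Fin m) (Fin n → Fin m) ℂ :=
  Matrix.of fun x y =>
    ∑ a : Fin n → Fin k, ∏ i : Fin n, A (a (finRotate n i), x i) (a i, y i)

/-- `C₁₂`: the matrix indexed by `Fin k × Fin k × Fin m` acting as `C` on the first two
factors and as the identity on the third. -/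
noncomputable def act12 (k m : ℕ) (C : Matrix (Fin k × Fin k) (Fin k × Fin k) ℂ) :
    Matrix (Fin k × Fin k × Fin m) (Fin k × Fin k × Fin m) ℂ :=
  Matrix.of fun (a, b, c) (d, e, f) => C (a, b) (d, e) * (if c = f then 1 else 0)

/-- `A₁₃`: the matrix indexed by `Fin k × Fin k × Fin m` acting as `A` on the first and
third factors and as the identity on the second. -/
noncomputable def act13 (k m : ℕ) (A : Matrix (Fin k × Fin m) (Fin k × Fin m) ℂ) :
    Matrix (Fin k × Fin k × Fin m) (Fin k × Fin k × Fin m) ℂ :=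
  Matrix.of fun (a, b, c) (d, e, f) => A (a, c) (d, f) * (if b = e then 1 else 0)

/-- `B₂₃`: the matrix indexed by `Fin k × Fin k × Fin m` acting as `B` on the last two
factors and as the identity on the first. -/
noncomputable def act23 (k m : ℕ) (B : Matrix (Fin k × Fin m) (Fin k × Fin m) ℂ) :
    Matrix (Fin k × Fin k × Fin m) (Fin k × Fin k × Fin m) ℂ :=
  Matrix.of fun (a, b, c) (d, e, f) => B (b, c) (e, f) * (if a = d then 1 else 0)

/-- A sum over paths of products of matrix entries, weighted by a function of the end points,
is expressed through the entries of the ordered product of the matrices. -/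
theorem sum_path_weight_mul_prod {S R : Type*} [Fintype S] [DecidableEq S] [CommSemiring R]
    (n : ℕ) (L : Fin n → Matrix S S R) (g : S → S → R) :
    ∑ s : Fin (n + 1) → S, g (s 0) (s (Fin.last n)) * ∏ i : Fin n, L i (s i.succ) (s i.castSucc) =
      ∑ v, ∑ u, g v u * (List.ofFn L).reverse.prod u v := by
  induction n generalizing g with
  | zero =>
    rw [← (Equiv.funUnique (Fin 1) S).symm.sum_comp]
    simp [Matrix.one_apply]
  | succ n ih =>
    rw [← (Fin.consEquiv fun _ : Fin (n + 2) => S).sum_comp, Fintype.sum_prod_type]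
    refine Finset.sum_congr rfl fun v _ => ?_
    have h := ih (fun i => L i.succ) fun w u => g v u * L 0 w v
    simp only [Fin.consEquiv_apply, Fin.prod_univ_succ, Fin.cons_zero, Fin.cons_succ,
      ← Fin.succ_last, Fin.castSucc_zero, ← Fin.succ_castSucc, ← mul_assoc]
    rw [h, Finset.sum_comm]
    refine Finset.sum_congr rfl fun u _ => ?_
    rw [List.ofFn_succ, List.reverse_cons, List.prod_append, List.prod_singleton,
      Matrix.mul_apply, Finset.mul_sum]
    exact Finset.sum_congr rfl fun w _ => by ring

/-- The sum over closed paths of products of matrix entries is the trace of the ordered product. -/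
theorem sum_prod_finRotate_eq_trace {S R : Type*} [Fintype S] [DecidableEq S] [CommSemiring R]
    (n : ℕ) (L : Fin (n + 1) → Matrix S S R) :
    ∑ s : Fin (n + 1) → S, ∏ i, L i (s (finRotate (n + 1) i)) (s i) =
      (List.ofFn L).reverse.prod.trace := by
  have h := sum_path_weight_mul_prod n (fun i => L i.castSucc) (L (Fin.last n))
  rw [List.ofFn_succ', List.concat_eq_append, List.reverse_append, List.reverse_singleton,
    List.prod_append, List.prod_singleton, Matrix.trace]
  simp only [Matrix.diag_apply, Matrix.mul_apply]
  rw [← h]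
  refine Finset.sum_congr rfl fun s _ => ?_
  rw [Fin.prod_univ_castSucc, finRotate_last, mul_comm]
  congr 1
  refine Finset.prod_congr rfl fun i _ => ?_
  rw [finRotate_apply, Fin.coeSucc_eq_succ]

theorem semiconjBy_prod_reverse_ofFn {M : Type*} [Monoid M] {c : M} (n : ℕ) (f g : Fin n → M)
    (h : ∀ i, SemiconjBy c (f i) (g i)) :
    SemiconjBy c (List.ofFn f).reverse.prod (List.ofFn g).reverse.prod := by
  induction n with
  | zero => simp
  | succ n ih =>
    simp only [List.ofFn_succ, List.reverse_cons, List.prod_append, List.prod_singleton]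
    exact (ih _ _ fun i => h i.succ).mul_right (h 0)

theorem Matrix.trace_eq_of_semiconjBy {S R : Type*} [Fintype S] [DecidableEq S] [CommSemiring R]
    {C X Y : Matrix S S R} (hC : IsUnit C) (h : SemiconjBy C X Y) : X.trace = Y.trace := by
  obtain ⟨c, rfl⟩ := hC
  rw [← Units.mul_inv_eq_iff_eq_mul c |>.mpr h.eq, Matrix.trace_mul_comm, Units.inv_mul_cancel_left]

theorem transferMatrix_mul_apply (k m n : ℕ) (A B : Matrix (Fin k × Fin m) (Fin k × Fin m) ℂ)
    (x z : Fin n → Fin m) :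
    (transferMatrix k m n A * transferMatrix k m n B) x z =
      ∑ s : Fin n → Fin k × Fin k, ∏ i, ∑ y,
        A ((s (finRotate n i)).1, x i) ((s i).1, y) *
          B ((s (finRotate n i)).2, y) ((s i).2, z i) := by
  simp only [Finset.prod_univ_sum, Fintype.piFinset_univ]
  rw [Finset.sum_comm, Matrix.mul_apply]
  refine Finset.sum_congr rfl fun y _ => ?_
  rw [← (Equiv.arrowProdEquivProdArrow (Fin n) (fun _ => Fin k) (fun _ => Fin k)).symm.sum_comp,
    Fintype.sum_prod_type]
  simp [transferMatrix, Finset.sum_mul_sum, Finset.prod_mul_distrib]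

/-- The block, between two physical states, of a matrix on two auxiliary factors and a
physical one. -/
def physicalBlock {k m : ℕ} (N : Matrix (Fin k × Fin k × Fin m) (Fin k × Fin k × Fin m) ℂ)
    (x z : Fin m) : Matrix (Fin k × Fin k) (Fin k × Fin k) ℂ :=
  Matrix.of fun p q => N (p.1, p.2, x) (q.1, q.2, z)

theorem physicalBlock_act12_mul {k m : ℕ} (C : Matrix (Fin k × Fin k) (Fin k × Fin k) ℂ)
    (N : Matrix (Fin k × Fin k × Fin m) (Fin k × Fin k × Fin m) ℂ) (x z : Fin m) :
    physicalBlock (act12 k m C * N) x z = C * physicalBlock N x z := by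
  ext p q
  simp [physicalBlock, act12, Matrix.mul_apply, Fintype.sum_prod_type]

theorem physicalBlock_mul_act12 {k m : ℕ} (C : Matrix (Fin k × Fin k) (Fin k × Fin k) ℂ)
    (N : Matrix (Fin k × Fin k × Fin m) (Fin k × Fin k × Fin m) ℂ) (x z : Fin m) :
    physicalBlock (N * act12 k m C) x z = physicalBlock N x z * C := by
  ext p q
  simp [physicalBlock, act12, Matrix.mul_apply, Fintype.sum_prod_type]

theorem physicalBlock_act13_mul_act23_apply {k m : ℕ}
    (A B : Matrix (Fin k × Fin m) (Fin k × Fin m) ℂ) (x z : Fin m) (p q : Fin k × Fin k) :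
    physicalBlock (act13 k m A * act23 k m B) x z p q =
      ∑ y, A (p.1, x) (q.1, y) * B (p.2, y) (q.2, z) := by
  simp only [physicalBlock, act13, act23, Matrix.mul_apply, Fintype.sum_prod_type, Matrix.of_apply]
  rw [Finset.sum_eq_single q.1 (by simp +contextual) (by simp),
    Finset.sum_eq_single p.2 (by simp +contextual [eq_comm]) (by simp)]
  simp

theorem physicalBlock_act23_mul_act13_apply {k m : ℕ}
    (A B : Matrix (Fin k × Fin m) (Fin k × Fin m) ℂ) (x z : Fin m) (p q : Fin k × Fin k) :
    physicalBlock (act23 k m B * act13 k m A) x z p q =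
      ∑ y, B (p.2, x) (q.2, y) * A (p.1, y) (q.1, z) := by
  simp only [physicalBlock, act13, act23, Matrix.mul_apply, Fintype.sum_prod_type, Matrix.of_apply]
  rw [Finset.sum_eq_single p.1 (by simp +contextual [eq_comm]) (by simp),
    Finset.sum_eq_single q.2 (by simp +contextual) (by simp)]
  simp

/-- If `C₁₂ A₁₃ B₂₃ = B₂₃ A₁₃ C₁₂` for some invertible `C`, then the transfer matrices of
`A` and `B` with periodic boundary conditions commute for every row length `n ≥ 1`. -/
theorem transfer_matrices_commute (k m : ℕ) (hk : 1 ≤ k) (hm : 1 ≤ m)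
    (A B : Matrix (Fin k × Fin m) (Fin k × Fin m) ℂ)
    (C : Matrix (Fin k × Fin k) (Fin k × Fin k) ℂ) (hC : IsUnit C)
    (hYBE : act12 k m C * act13 k m A * act23 k m B =
            act23 k m B * act13 k m A * act12 k m C) :
    ∀ n : ℕ, 1 ≤ n →
      transferMatrix k m n A * transferMatrix k m n B =
      transferMatrix k m n B * transferMatrix k m n A := by
  intro n hn
  obtain ⟨n, rfl⟩ := Nat.exists_eq_add_of_le' hn
  ext x z
  have hblock (x z : Fin m) : SemiconjBy C (physicalBlock (act13 k m A * act23 k m B) x z)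
      (physicalBlock (act23 k m B * act13 k m A) x z) := by
    rw [SemiconjBy, ← physicalBlock_act12_mul, ← physicalBlock_mul_act12, ← mul_assoc, hYBE]
  have htrace := Matrix.trace_eq_of_semiconjBy hC
    (semiconjBy_prod_reverse_ofFn (n + 1) _ _ fun i => hblock (x i) (z i))
  rw [← sum_prod_finRotate_eq_trace, ← sum_prod_finRotate_eq_trace] at htrace
  simp only [physicalBlock_act13_mul_act23_apply, physicalBlock_act23_mul_act13_apply] at htrace
  rw [transferMatrix_mul_apply, transferMatrix_mul_apply, htrace,
    ← ((Equiv.refl (Fin (n + 1))).arrowCongr (Equiv.prodComm (Fin k) (Fin k))).sum_comp]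
  simp
end

section
/- Let Q ≥ 1 and n ≥ 1 be integers. The 2n−1 Potts-model operators E₁,…,E_{2n−1} satisfy the Temperley–Lieb relations with parameter δ = √Q: E_k² = √Q · E_k for every k; E_k E_{k+1} E_k = E_k and E_{k+1} E_k E_{k+1} = E_{k+1} for every 1 ≤ k ≤ 2n−2; and E_k E_l = E_l E_k whenever |k−l| ≥ 2. -/
open Matrix

/-- The Potts-model Temperley–Lieb operators `E_k` (`1 ≤ k ≤ 2n − 1`) acting on
`(ℂ^Q)^{⊗n}`, regarded as matrices indexed by functions `Fin n → Fin Q`.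
For odd `k = 2i − 1` (site `i`, 1-based; `k / 2 = i − 1`, 0-based):
`(E_{2i−1}) x y = Q^{−1/2}` if `x j = y j` for all `j ≠ i`, else `0`.
For even `k = 2i`: `(E_{2i}) x y = Q^{1/2}` if `x = y` and `x i = x (i+1)`, else `0`. -/
noncomputable def pottsE (Q n : ℕ) (k : ℕ) :
    Matrix (Fin n → Fin Q) (Fin n → Fin Q) ℂ :=
  Matrix.of fun x y =>
    if k % 2 = 1 then
      if h : k / 2 < n then
        if ∀ j : Fin n, j ≠ ⟨k / 2, h⟩ → x j = y j then ((Real.sqrt Q : ℂ))⁻¹ else 0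
      else 0
    else
      if h : k / 2 < n then
        if h' : k / 2 - 1 < n then
          if x = y ∧ x ⟨k / 2 - 1, h'⟩ = x ⟨k / 2, h⟩ then (Real.sqrt Q : ℂ) else 0
        else 0
      else 0

/-- The matrix summing over all values at site `i`. -/
def siteSum {ι α : Type*} [Fintype ι] [DecidableEq ι] [DecidableEq α] (i : ι) :
    Matrix (ι → α) (ι → α) ℂ :=
  Matrix.of fun x y => if ∀ j, j ≠ i → x j = y j then 1 else 0

/-- The diagonal matrix projecting onto configurations with equal values at sites `i`, `j`. -/
def bondProj {ι α : Type*} [DecidableEq ι] [Fintype ι] [DecidableEq α] (i j : ι) :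
    Matrix (ι → α) (ι → α) ℂ :=
  Matrix.diagonal fun x => if x i = x j then 1 else 0

section

variable {ι α : Type*} [Fintype ι] [DecidableEq ι] [DecidableEq α]

theorem siteSum_update_left (i : ι) (x y : ι → α) (a : α) :
    (siteSum i : Matrix (ι → α) (ι → α) ℂ) (Function.update x i a) y = siteSum i x y := by
  have : (∀ j, j ≠ i → Function.update x i a j = y j) ↔ ∀ j, j ≠ i → x j = y j :=
    forall₂_congr fun j hj => by simp [hj]
  simp only [siteSum, Matrix.of_apply, this]

theorem bondProj_symm (i j : ι) :
    (bondProj i j : Matrix (ι → α) (ι → α) ℂ) = bondProj j i := by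
  simp only [bondProj, eq_comm]

variable [Fintype α]

theorem siteSum_mul_apply (i : ι) (M : Matrix (ι → α) (ι → α) ℂ) (x y : ι → α) :
    (siteSum i * M : Matrix (ι → α) (ι → α) ℂ) x y = ∑ a, M (Function.update x i a) y := by
  rw [Matrix.mul_apply]
  symm
  refine Finset.sum_of_injOn (fun a => Function.update x i a)
    (fun a _ b _ h => Function.update_injective x i h) (fun _ _ => Finset.mem_univ _) ?_ ?_
  · intro z _ hz
    have : ¬ ∀ j, j ≠ i → x j = z j := fun h => hz ⟨z i, by simp, by
      funext j
      by_cases hj : j = i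
      · subst hj; simp
      · simp [hj, h j hj]⟩
    simp [siteSum, this]
  · intro a _
    have : ∀ j, j ≠ i → x j = Function.update x i a j := fun j hj => by simp [hj]
    rw [siteSum, Matrix.of_apply, if_pos this, one_mul]

theorem siteSum_mul_self (i : ι) :
    (siteSum i * siteSum i : Matrix (ι → α) (ι → α) ℂ) = (Fintype.card α : ℂ) • siteSum i := by
  ext x y
  simp [siteSum_mul_apply, siteSum_update_left]

theorem siteSum_comm (i k : ι) :
    (siteSum i * siteSum k : Matrix (ι → α) (ι → α) ℂ) = siteSum k * siteSum i := by
  obtain rfl | hik := eq_or_ne i k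
  · rfl
  rw [← Matrix.mul_one (siteSum i * siteSum k), ← Matrix.mul_one (siteSum k * siteSum i)]
  ext x y
  simp only [Matrix.mul_assoc, siteSum_mul_apply]
  rw [Finset.sum_comm]
  exact Finset.sum_congr rfl fun a _ => Finset.sum_congr rfl fun b _ => by
    rw [Function.update_comm hik]

theorem bondProj_mul_self (i j : ι) :
    (bondProj i j * bondProj i j : Matrix (ι → α) (ι → α) ℂ) = bondProj i j := by
  simp [bondProj, Matrix.diagonal_mul_diagonal]

theorem bondProj_comm (i j k l : ι) :
    (bondProj i j * bondProj k l : Matrix (ι → α) (ι → α) ℂ) = bondProj k l * bondProj i j := by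
  simp only [bondProj, Matrix.diagonal_mul_diagonal, mul_comm]

theorem siteSum_bondProj_siteSum {i j : ι} (h : i ≠ j) :
    (siteSum i * bondProj i j * siteSum i : Matrix (ι → α) (ι → α) ℂ) = siteSum i := by
  ext x y
  simp [Matrix.mul_assoc, siteSum_mul_apply, bondProj, Matrix.diagonal_mul, siteSum_update_left,
    h.symm]

theorem bondProj_siteSum_bondProj {i j : ι} (h : i ≠ j) :
    (bondProj i j * siteSum i * bondProj i j : Matrix (ι → α) (ι → α) ℂ) = bondProj i j := by
  ext x y
  rw [bondProj, Matrix.mul_diagonal, Matrix.diagonal_mul, Matrix.diagonal_apply]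
  by_cases hxy : x = y
  · subst hxy
    simp [siteSum]
  · rw [if_neg hxy]
    by_contra hne
    simp only [siteSum, Matrix.of_apply, mul_ite, mul_one, mul_zero] at hne
    apply hxy
    funext k
    by_cases hk : k = i
    · subst hk
      grind
    · grind

theorem siteSum_bondProj_comm {i k l : ι} (hk : k ≠ i) (hl : l ≠ i) :
    (siteSum i * bondProj k l : Matrix (ι → α) (ι → α) ℂ) = bondProj k l * siteSum i := by
  ext x y
  rw [bondProj, Matrix.mul_diagonal, Matrix.diagonal_mul]
  by_cases h : ∀ j, j ≠ i → x j = y j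
  · rw [h k hk, h l hl, mul_comm]
  · simp [siteSum, h]

end

theorem pottsE_odd (Q n i : ℕ) (h : i < n) :
    pottsE Q n (2 * i + 1) = (Real.sqrt Q : ℂ)⁻¹ • siteSum ⟨i, h⟩ := by
  have h1 : (2 * i + 1) % 2 = 1 := by omega
  have h2 : (2 * i + 1) / 2 = i := by omega
  ext x y
  simp [pottsE, siteSum, h1, h2, h]

theorem pottsE_even (Q n i : ℕ) (h : i + 1 < n) :
    pottsE Q n (2 * i + 2) =
      (Real.sqrt Q : ℂ) • bondProj ⟨i, Nat.lt_of_succ_lt h⟩ ⟨i + 1, h⟩ := by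
  have h1 : (2 * i + 2) % 2 = 0 := by omega
  have h2 : (2 * i + 2) / 2 = i + 1 := by omega
  ext x y
  simp [pottsE, bondProj, h1, h2, h, Nat.lt_of_succ_lt h, Matrix.diagonal_apply, ite_and]

theorem exists_odd_or_even_index {n k : ℕ} (hk : 1 ≤ k) (hkn : k ≤ 2 * n - 1) :
    (∃ i, i < n ∧ k = 2 * i + 1) ∨ ∃ i, i + 1 < n ∧ k = 2 * i + 2 := by
  obtain h | h := Nat.mod_two_eq_zero_or_one k
  · exact Or.inr ⟨k / 2 - 1, by omega, by omega⟩
  · exact Or.inl ⟨k / 2, by omega, by omega⟩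

/-- The Potts-model operators `E₁, …, E_{2n−1}` satisfy the Temperley–Lieb relations with
parameter `δ = √Q`. -/
theorem pottsE_temperley_lieb (Q n : ℕ) (hQ : 1 ≤ Q) (hn : 1 ≤ n) :
    (∀ k : ℕ, 1 ≤ k → k ≤ 2 * n - 1 →
      pottsE Q n k * pottsE Q n k = (Real.sqrt Q : ℂ) • pottsE Q n k) ∧
    (∀ k : ℕ, 1 ≤ k → k ≤ 2 * n - 2 →
      pottsE Q n k * pottsE Q n (k + 1) * pottsE Q n k = pottsE Q n k ∧
      pottsE Q n (k + 1) * pottsE Q n k * pottsE Q n (k + 1) = pottsE Q n (k + 1)) ∧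
    (∀ k l : ℕ, 1 ≤ k → k ≤ 2 * n - 1 → 1 ≤ l → l ≤ 2 * n - 1 →
      2 ≤ |(k : ℤ) - (l : ℤ)| →
      pottsE Q n k * pottsE Q n l = pottsE Q n l * pottsE Q n k) := by
  have hs : (Real.sqrt Q : ℂ) ≠ 0 := by
    exact_mod_cast (Real.sqrt_pos.2 (by exact_mod_cast hQ)).ne'
  have hsq : (Q : ℂ) = Real.sqrt Q * Real.sqrt Q := by
    exact_mod_cast (Real.mul_self_sqrt (Nat.cast_nonneg Q)).symm
  refine ⟨fun k hk hkn => ?_, fun k hk hkn => ?_, fun k l hk hkn hl hln hkl => ?_⟩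
  · obtain ⟨i, hi, rfl⟩ | ⟨i, hi, rfl⟩ := exists_odd_or_even_index hk hkn
    · rw [pottsE_odd Q n i hi, Matrix.smul_mul, Matrix.mul_smul, siteSum_mul_self,
        Fintype.card_fin, hsq]
      simp only [smul_smul]
      congr 1
      field_simp
    · rw [pottsE_even Q n i hi, Matrix.smul_mul, Matrix.mul_smul, bondProj_mul_self]
  · obtain ⟨i, hi, rfl⟩ | ⟨i, hi, rfl⟩ := exists_odd_or_even_index hk (n := n) (by omega)
    · have hi' : i + 1 < n := by omega
      have hne : (⟨i, hi⟩ : Fin n) ≠ ⟨i + 1, hi'⟩ := by simp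
      rw [pottsE_odd Q n i hi, pottsE_even Q n i hi']
      simp only [Matrix.smul_mul, Matrix.mul_smul, siteSum_bondProj_siteSum hne,
        bondProj_siteSum_bondProj hne, smul_smul]
      constructor <;> congr 1 <;> field_simp
    · have hne : (⟨i + 1, hi⟩ : Fin n) ≠ ⟨i, Nat.lt_of_succ_lt hi⟩ := by simp
      rw [pottsE_even Q n i hi, bondProj_symm,
        show 2 * i + 2 + 1 = 2 * (i + 1) + 1 by ring, pottsE_odd Q n (i + 1) hi]
      simp only [Matrix.smul_mul, Matrix.mul_smul, siteSum_bondProj_siteSum hne,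
        bondProj_siteSum_bondProj hne, smul_smul]
      constructor <;> congr 1 <;> field_simp
  · rw [le_abs] at hkl
    obtain ⟨i, hi, rfl⟩ | ⟨i, hi, rfl⟩ := exists_odd_or_even_index hk hkn <;>
      obtain ⟨j, hj, rfl⟩ | ⟨j, hj, rfl⟩ := exists_odd_or_even_index hl hln
    · rw [pottsE_odd Q n i hi, pottsE_odd Q n j hj]
      simp only [Matrix.smul_mul, Matrix.mul_smul]
      rw [siteSum_comm, smul_comm]
    · rw [pottsE_odd Q n i hi, pottsE_even Q n j hj]
      simp only [Matrix.smul_mul, Matrix.mul_smul]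
      rw [siteSum_bondProj_comm, smul_comm]
      all_goals
        rw [Ne, Fin.mk.injEq]
        omega
    · rw [pottsE_even Q n i hi, pottsE_odd Q n j hj]
      simp only [Matrix.smul_mul, Matrix.mul_smul]
      rw [siteSum_bondProj_comm, smul_comm]
      all_goals
        rw [Ne, Fin.mk.injEq]
        omega
    · rw [pottsE_even Q n i hi, pottsE_even Q n j hj]
      simp only [Matrix.smul_mul, Matrix.mul_smul]
      rw [bondProj_comm]
end

section
/- For every nonzero complex number q and every n ≥ 2, the operators E₁,…,E_{n−1} on (ℂ²)^{⊗n} obtained by placing the matrix E in tensor positions (i, i+1) satisfy the Temperley–Lieb relations with parameter δ = q + q⁻¹: E_i² = (q+q⁻¹)·E_i, E_i E_{i±1} E_i = E_i, and E_i E_j = E_j E_i whenever |i−j| ≥ 2. -/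
open Matrix

/-- The 4×4 matrix `E` (rows and columns indexed by the ordered basis
`(e₀⊗e₀, e₀⊗e₁, e₁⊗e₀, e₁⊗e₁)` of `ℂ²⊗ℂ²`) whose `(2,2)` entry is `q⁻¹`, `(3,3)` entry is
`q`, `(2,3)` and `(3,2)` entries are `1`, and all other entries `0`. -/
noncomputable def Emat (q : ℂ) : Matrix (Fin 2 × Fin 2) (Fin 2 × Fin 2) ℂ :=
  Matrix.of fun (a, b) (c, d) =>
    if a = c ∧ b = d then
      if a = b then 0
      else if a = 0 then q⁻¹ else q
    else if a = d ∧ b = c ∧ a ≠ b then 1 else 0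

/-- The operator on `(ℂ²)^{⊗n}` acting as the 4×4 matrix `M` on the (0-based) tensor
factors `s` and `s + 1` and as the identity on all other factors. -/
noncomputable def opAt (n : ℕ) (M : Matrix (Fin 2 × Fin 2) (Fin 2 × Fin 2) ℂ) (s : ℕ) :
    Matrix (Fin n → Fin 2) (Fin n → Fin 2) ℂ :=
  Matrix.of fun x y =>
    if h : s + 1 < n then
      M (x ⟨s, by omega⟩, x ⟨s + 1, h⟩) (y ⟨s, by omega⟩, y ⟨s + 1, h⟩) *
        ∏ j ∈ Finset.univ.filter
            (fun j : Fin n => j ≠ ⟨s, by omega⟩ ∧ j ≠ ⟨s + 1, h⟩),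
          (if x j = y j then 1 else 0)
    else 0

/-- `E_i` (`1 ≤ i ≤ n − 1`, 1-based): the matrix `Emat q` placed in tensor positions
`(i, i+1)` of `(ℂ²)^{⊗n}`. -/
noncomputable def iceE (q : ℂ) (n : ℕ) (i : ℕ) :
    Matrix (Fin n → Fin 2) (Fin n → Fin 2) ℂ :=
  opAt n (Emat q) (i - 1)

/-- The matrix elements of `opAt` give the operator that sums over the values of the two factors
it acts on. -/
theorem opAt_mulVec {n : ℕ} (M : Matrix (Fin 2 × Fin 2) (Fin 2 × Fin 2) ℂ) {s : ℕ} {a b : Fin n}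
    (ha : (a : ℕ) = s) (hb : (b : ℕ) = s + 1) (f : (Fin n → Fin 2) → ℂ) (x : Fin n → Fin 2) :
    (opAt n M s *ᵥ f) x = ∑ p : Fin 2 × Fin 2,
      M (x a, x b) p * f (Function.update (Function.update x a p.1) b p.2) := by
  have hab : a ≠ b := fun h => by rw [h] at ha; omega
  have hs : s + 1 < n := hb ▸ b.isLt
  have hA : (⟨s, by omega⟩ : Fin n) = a := Fin.ext ha.symm
  have hB : (⟨s + 1, hs⟩ : Fin n) = b := Fin.ext hb.symm
  simp only [mulVec, dotProduct, opAt, of_apply, dif_pos hs, hA, hB, Finset.prod_ite_zero,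
    Finset.prod_const_one]
  symm
  refine Finset.sum_of_injOn
    (fun p : Fin 2 × Fin 2 => Function.update (Function.update x a p.1) b p.2) ?_ ?_ ?_ ?_
  · rintro ⟨i, j⟩ - ⟨i', j'⟩ - h
    have h₁ := congrFun h a
    have h₂ := congrFun h b
    simp [hab] at h₁ h₂
    simp [h₁, h₂]
  · intro p _
    simp
  · intro y _ hy
    rw [if_neg, mul_zero, zero_mul]
    intro h
    refine hy ⟨(y a, y b), by simp, ?_⟩
    funext j
    by_cases hjb : j = b
    · subst hjb; simp
    by_cases hja : j = a
    · subst hja; simp [hab]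
    simpa [hja, hjb] using h j (by simp [hja, hjb])
  · rintro ⟨i, j⟩ _
    rw [if_pos]
    · simp [hab]
    · intro k hk
      simp only [Finset.mem_filter] at hk
      simp [hk.2.1, hk.2.2]

/-- Two matrices are equal once they act equally on all vectors. -/
theorem Matrix.ext_of_mulVec_apply {ι : Type*} [Fintype ι] [DecidableEq ι] {A B : Matrix ι ι ℂ}
    (h : ∀ f x, (A *ᵥ f) x = (B *ᵥ f) x) : A = B :=
  Matrix.ext_of_mulVec_single fun _ => funext fun _ => h _ _

theorem opAt_Emat_mul_self {q : ℂ} (hq : q ≠ 0) {n s : ℕ} (hs : s + 1 < n) :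
    opAt n (Emat q) s * opAt n (Emat q) s = (q + q⁻¹) • opAt n (Emat q) s := by
  refine Matrix.ext_of_mulVec_apply fun f x => ?_
  obtain ⟨a, ha⟩ : ∃ a : Fin n, (a : ℕ) = s := ⟨⟨s, by omega⟩, rfl⟩
  obtain ⟨b, hb⟩ : ∃ b : Fin n, (b : ℕ) = s + 1 := ⟨⟨s + 1, hs⟩, rfl⟩
  have hab : a ≠ b := fun h => by rw [h] at ha; omega
  rw [← mulVec_mulVec, smul_mulVec, Pi.smul_apply]
  have key (i j k l : Fin 2) :
      Function.update (Function.update (Function.update (Function.update x a i) b j) a k) b l =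
        Function.update (Function.update x a k) b l := by
    funext t
    simp only [Function.update_apply]
    grind
  simp only [opAt_mulVec _ ha hb, key, Function.update_self, Function.update_of_ne hab]
  generalize x a = i
  generalize x b = j
  fin_cases i <;> fin_cases j <;>
    simp [Fintype.sum_prod_type, Emat] <;> field_simp <;> ring

/-- The two cubic relations on three adjacent factors. -/
theorem opAt_Emat_mul_mul {q : ℂ} (hq : q ≠ 0) {n s : ℕ} (hs : s + 2 < n) :
    opAt n (Emat q) s * opAt n (Emat q) (s + 1) * opAt n (Emat q) s = opAt n (Emat q) s ∧
    opAt n (Emat q) (s + 1) * opAt n (Emat q) s * opAt n (Emat q) (s + 1) =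
      opAt n (Emat q) (s + 1) := by
  obtain ⟨a, ha⟩ : ∃ a : Fin n, (a : ℕ) = s := ⟨⟨s, by omega⟩, rfl⟩
  obtain ⟨b, hb⟩ : ∃ b : Fin n, (b : ℕ) = s + 1 := ⟨⟨s + 1, by omega⟩, rfl⟩
  obtain ⟨c, hc⟩ : ∃ c : Fin n, (c : ℕ) = s + 1 + 1 := ⟨⟨s + 2, hs⟩, rfl⟩
  have hab : a ≠ b := fun h => by rw [h] at ha; omega
  have hac : a ≠ c := fun h => by rw [h] at ha; omega
  have hbc : b ≠ c := fun h => by rw [h] at hb; omega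
  let u (x : Fin n → Fin 2) (i j k : Fin 2) : Fin n → Fin 2 :=
    Function.update (Function.update (Function.update x a i) b j) c k
  have hu (x) : u x (x a) (x b) (x c) = x := by simp [u]
  have left (f x i j k) : (opAt n (Emat q) s *ᵥ f) (u x i j k) =
      ∑ p : Fin 2 × Fin 2, Emat q (i, j) p * f (u x p.1 p.2 k) := by
    rw [opAt_mulVec _ ha hb]
    refine Finset.sum_congr rfl fun p _ => ?_
    congr 2
    · simp [u, hab, hac, hbc]
    · funext t
      simp only [u, Function.update_apply]
      grind
  have right (f x i j k) : (opAt n (Emat q) (s + 1) *ᵥ f) (u x i j k) =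
      ∑ p : Fin 2 × Fin 2, Emat q (j, k) p * f (u x i p.1 p.2) := by
    rw [opAt_mulVec _ hb hc]
    refine Finset.sum_congr rfl fun p _ => ?_
    congr 2
    · simp [u, hbc]
    · funext t
      simp only [u, Function.update_apply]
      grind
  constructor <;> refine Matrix.ext_of_mulVec_apply fun f x => ?_ <;>
    rw [← mulVec_mulVec, ← mulVec_mulVec, ← hu x] <;>
    simp only [left, right] <;>
    generalize x a = i <;> generalize x b = j <;> generalize x c = k <;>
    fin_cases i <;> fin_cases j <;> fin_cases k <;>
    simp [Fintype.sum_prod_type, Emat, hq, mul_add]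

theorem opAt_mul_comm (M N : Matrix (Fin 2 × Fin 2) (Fin 2 × Fin 2) ℂ) {n s t : ℕ}
    (hst : s + 2 ≤ t) (ht : t + 1 < n) :
    opAt n M s * opAt n N t = opAt n N t * opAt n M s := by
  refine Matrix.ext_of_mulVec_apply fun f x => ?_
  obtain ⟨a, ha⟩ : ∃ a : Fin n, (a : ℕ) = s := ⟨⟨s, by omega⟩, rfl⟩
  obtain ⟨b, hb⟩ : ∃ b : Fin n, (b : ℕ) = s + 1 := ⟨⟨s + 1, by omega⟩, rfl⟩
  obtain ⟨c, hc⟩ : ∃ c : Fin n, (c : ℕ) = t := ⟨⟨t, by omega⟩, rfl⟩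
  obtain ⟨d, hd⟩ : ∃ d : Fin n, (d : ℕ) = t + 1 := ⟨⟨t + 1, ht⟩, rfl⟩
  have hac : a ≠ c := fun h => by rw [h] at ha; omega
  have had : a ≠ d := fun h => by rw [h] at ha; omega
  have hbc : b ≠ c := fun h => by rw [h] at hb; omega
  have hbd : b ≠ d := fun h => by rw [h] at hb; omega
  rw [← mulVec_mulVec, ← mulVec_mulVec]
  simp only [opAt_mulVec _ ha hb, opAt_mulVec _ hc hd, Finset.mul_sum]
  rw [Finset.sum_comm]
  refine Finset.sum_congr rfl fun p _ => Finset.sum_congr rfl fun r _ => ?_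
  simp only [Function.update_of_ne hac, Function.update_of_ne had, Function.update_of_ne hbc,
    Function.update_of_ne hbd, Function.update_of_ne hac.symm, Function.update_of_ne had.symm,
    Function.update_of_ne hbc.symm, Function.update_of_ne hbd.symm]
  rw [mul_left_comm]
  congr 3
  rw [Function.update_comm hbc, Function.update_comm hac, Function.update_comm hbd,
    Function.update_comm had]

/-- The operators `E₁, …, E_{n−1}` obtained from the six-vertex matrix `E` satisfy the
Temperley–Lieb relations with parameter `δ = q + q⁻¹`. -/
theorem iceE_temperley_lieb (q : ℂ) (hq : q ≠ 0) (n : ℕ) (hn : 2 ≤ n) :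
    (∀ i : ℕ, 1 ≤ i → i ≤ n - 1 →
      iceE q n i * iceE q n i = (q + q⁻¹) • iceE q n i) ∧
    (∀ i : ℕ, 1 ≤ i → i + 1 ≤ n - 1 →
      iceE q n i * iceE q n (i + 1) * iceE q n i = iceE q n i ∧
      iceE q n (i + 1) * iceE q n i * iceE q n (i + 1) = iceE q n (i + 1)) ∧
    (∀ i j : ℕ, 1 ≤ i → i ≤ n - 1 → 1 ≤ j → j ≤ n - 1 →
      2 ≤ |(i : ℤ) - (j : ℤ)| →
      iceE q n i * iceE q n j = iceE q n j * iceE q n i) := by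
  refine ⟨fun i hi hin => opAt_Emat_mul_self hq (by omega), fun i hi hin => ?_,
    fun i j hi hin hj hjn hij => ?_⟩
  · obtain ⟨s, rfl⟩ : ∃ s, i = s + 1 := ⟨i - 1, by omega⟩
    exact opAt_Emat_mul_mul hq (by omega)
  · rcases le_abs.mp hij with h | h
    · exact (opAt_mul_comm _ _ (by omega) (by omega)).symm
    · exact opAt_mul_comm _ _ (by omega) (by omega)
end

section
/- Let A be a unital associative algebra over a field F, δ ∈ F, and let E₁,…,E_{2n−1} ∈ A satisfy the Temperley–Lieb relations with parameter δ. Set P = E₁E₃E₅⋯E_{2n−1} (the product of the odd-indexed generators). Then for every element x of the subalgebra of A generated by E₁,…,E_{2n−1} there exists a scalar c ∈ F such that P·x·P = c·P. -/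
/-- The Temperley–Lieb relations with parameter `δ` for `E 1, …, E L`. -/
structure TemperleyLiebRelations {F A : Type*} [Field F] [Ring A] [Algebra F A]
    (δ : F) (E : ℕ → A) (L : ℕ) : Prop where
  sq : ∀ k, 1 ≤ k → k ≤ L → E k * E k = δ • E k
  braid : ∀ k, 1 ≤ k → k + 1 ≤ L → E (k + 1) * E k * E (k + 1) = E (k + 1)
  comm : ∀ k l, 1 ≤ k → k + 2 ≤ l → l ≤ L → E l * E k = E k * E l

namespace TemperleyLiebRelations

variable {F A : Type*} [Field F] [Ring A] [Algebra F A] {δ : F} {E : ℕ → A} {L : ℕ}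

variable (F E) in
/-- The subalgebra generated by `E 1, …, E m`. -/
def gen (m : ℕ) : Subalgebra F A :=
  Algebra.adjoin F {a : A | ∃ k : ℕ, 1 ≤ k ∧ k ≤ m ∧ a = E k}

theorem mem_gen {k m : ℕ} (h1 : 1 ≤ k) (h2 : k ≤ m) : E k ∈ gen F E m :=
  Algebra.subset_adjoin ⟨k, h1, h2, rfl⟩

theorem gen_mono {k m : ℕ} (h : k ≤ m) : gen F E k ≤ gen F E m :=
  Algebra.adjoin_mono fun _ ⟨j, h1, h2, h3⟩ => ⟨j, h1, h2.trans h, h3⟩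

theorem exists_algebraMap_of_mem_gen_zero {x : A} (hx : x ∈ gen F E 0) :
    ∃ c : F, x = algebraMap F A c := by
  have h : {a : A | ∃ k : ℕ, 1 ≤ k ∧ k ≤ 0 ∧ a = E k} = ∅ := by
    ext a
    simp only [Set.mem_ofPred_eq, Set.mem_empty_iff_false, iff_false]
    rintro ⟨k, h1, h2, -⟩
    omega
  rw [gen, h, Algebra.adjoin_empty, Algebra.mem_bot] at hx
  obtain ⟨c, rfl⟩ := hx
  exact ⟨c, rfl⟩

theorem commute_of_mem_gen (h : TemperleyLiebRelations δ E L) {k l : ℕ} (hkl : k + 2 ≤ l)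
    (hl : l ≤ L) {x : A} (hx : x ∈ gen F E k) : E l * x = x * E l := by
  induction hx using Algebra.adjoin_induction with
  | mem x hx =>
    obtain ⟨j, h1, h2, rfl⟩ := hx
    exact h.comm j l h1 (by omega) hl
  | algebraMap r => exact (Algebra.commutes r (E l)).symm
  | add x y _ _ hx hy => rw [mul_add, add_mul, hx, hy]
  | mul x y _ _ hx hy => rw [← mul_assoc, hx, mul_assoc, hy, mul_assoc]

variable (F E) in
/-- The span of the elements of `gen F E m` and of the products `a * E (m + 1) * b` with `a`, `b`
in `gen F E m`. -/
def normalSpan (m : ℕ) : Submodule F A :=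
  Submodule.span F {z | z ∈ gen F E m ∨
    ∃ a ∈ gen F E m, ∃ b ∈ gen F E m, z = a * E (m + 1) * b}

/-- If `E (m + 1) * x * E (m + 1)` lies in `gen F E m * E (m + 1)` for all `x` in `gen F E m`,
then every element of `gen F E (m + 1)` is a combination of words with at most one `E (m + 1)`. -/
theorem gen_succ_le_normalSpan {m : ℕ}
    (hm : ∀ x ∈ gen F E m, ∃ y ∈ gen F E m, E (m + 1) * x * E (m + 1) = y * E (m + 1))
    {x : A} (hx : x ∈ gen F E (m + 1)) : x ∈ normalSpan F E m := by
  suffices H : ∀ z ∈ normalSpan F E m, x * z ∈ normalSpan F E m by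
    simpa using H 1 (Submodule.subset_span (Or.inl (one_mem _)))
  induction hx using Algebra.adjoin_induction with
  | mem x hx =>
    obtain ⟨j, h1, h2, rfl⟩ := hx
    intro z hz
    induction hz using Submodule.span_induction with
    | zero => simp
    | add u v _ _ hu hv => rw [mul_add]; exact add_mem hu hv
    | smul r u _ hu => rw [mul_smul_comm]; exact Submodule.smul_mem _ r hu
    | mem z hz =>
      apply Submodule.subset_span
      rcases Nat.lt_or_ge m j with hj | hj
      · obtain rfl : j = m + 1 := by omega
        right
        rcases hz with hz | ⟨a, ha, b, hb, rfl⟩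
        · exact ⟨1, one_mem _, z, hz, by rw [one_mul]⟩
        · obtain ⟨y, hy, e⟩ := hm a ha
          exact ⟨y, hy, b, hb, by rw [← e]; simp only [mul_assoc]⟩
      · rcases hz with hz | ⟨a, ha, b, hb, rfl⟩
        · exact Or.inl (mul_mem (mem_gen h1 hj) hz)
        · exact Or.inr ⟨E j * a, mul_mem (mem_gen h1 hj) ha, b, hb, by simp only [mul_assoc]⟩
  | algebraMap r =>
    intro z hz
    rw [← Algebra.smul_def]
    exact Submodule.smul_mem _ r hz
  | add x y _ _ hx hy =>
    intro z hz
    rw [add_mul]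
    exact add_mem (hx z hz) (hy z hz)
  | mul x y _ _ hx hy =>
    intro z hz
    rw [mul_assoc]
    exact hx _ (hy z hz)

theorem exists_mul_eq_of_span {e : A} {B : Subalgebra F A} {s : Set A}
    (hs : ∀ z ∈ s, ∃ y ∈ B, e * z * e = y * e) {x : A} (hx : x ∈ Submodule.span F s) :
    ∃ y ∈ B, e * x * e = y * e := by
  induction hx using Submodule.span_induction with
  | mem z hz => exact hs z hz
  | zero => exact ⟨0, zero_mem _, by simp⟩
  | add u v _ _ hu hv =>
    obtain ⟨y, hy, e1⟩ := hu
    obtain ⟨w, hw, e2⟩ := hv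
    exact ⟨y + w, add_mem hy hw, by rw [mul_add, add_mul, e1, e2, add_mul]⟩
  | smul r u _ hu =>
    obtain ⟨y, hy, e1⟩ := hu
    exact ⟨r • y, B.smul_mem hy r, by rw [mul_smul_comm, smul_mul_assoc, e1, smul_mul_assoc]⟩

theorem exists_mul_eq (h : TemperleyLiebRelations δ E L) {m : ℕ} (hm : m + 1 ≤ L) :
    ∀ x ∈ gen F E m, ∃ y ∈ gen F E (m - 1), E (m + 1) * x * E (m + 1) = y * E (m + 1) := by
  induction m with
  | zero =>
    intro x hx
    obtain ⟨c, rfl⟩ := exists_algebraMap_of_mem_gen_zero hx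
    refine ⟨algebraMap F A (c * δ), Subalgebra.algebraMap_mem _ _, ?_⟩
    rw [← Algebra.commutes, mul_assoc, h.sq _ (by omega) hm, map_mul, mul_assoc,
      ← Algebra.smul_def δ]
  | succ m ih =>
    intro x hx
    have hN := gen_succ_le_normalSpan (fun x hx => by
      obtain ⟨y, hy, e⟩ := ih (by omega) x hx
      exact ⟨y, gen_mono (by omega) hy, e⟩) hx
    refine exists_mul_eq_of_span ?_ hN
    have hc {z : A} (hz : z ∈ gen F E m) : E (m + 1 + 1) * z = z * E (m + 1 + 1) :=
      h.commute_of_mem_gen le_rfl hm hz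
    rintro z (hz | ⟨a, ha, b, hb, rfl⟩)
    · refine ⟨δ • z, Subalgebra.smul_mem _ hz δ, ?_⟩
      rw [hc hz, mul_assoc, h.sq _ (by omega) hm, mul_smul_comm, smul_mul_assoc]
    · refine ⟨a * b, mul_mem ha hb, ?_⟩
      calc E (m + 1 + 1) * (a * E (m + 1) * b) * E (m + 1 + 1)
          = (E (m + 1 + 1) * a) * E (m + 1) * (b * E (m + 1 + 1)) := by simp only [mul_assoc]
        _ = a * (E (m + 1 + 1) * E (m + 1) * E (m + 1 + 1)) * b := by
          rw [hc ha, ← hc hb]; simp only [mul_assoc]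
        _ = a * b * E (m + 1 + 1) := by
          rw [h.braid _ (by omega) hm, mul_assoc, hc hb, mul_assoc]

theorem exists_mul_eq_succ (h : TemperleyLiebRelations δ E L) {m : ℕ} (hm : m + 1 ≤ L)
    {x : A} (hx : x ∈ gen F E (m + 1)) :
    ∃ y ∈ gen F E (m - 1), E (m + 1) * x * E (m + 1) = y * E (m + 1) := by
  have key := h.exists_mul_eq hm
  have hN := gen_succ_le_normalSpan (fun x hx => by
    obtain ⟨y, hy, e⟩ := key x hx
    exact ⟨y, gen_mono (by omega) hy, e⟩) hx
  refine exists_mul_eq_of_span ?_ hN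
  rintro z (hz | ⟨a, ha, b, hb, rfl⟩)
  · exact key z hz
  · obtain ⟨y, hy, e⟩ := key a ha
    obtain ⟨w, hw, e'⟩ := key b hb
    refine ⟨y * w, mul_mem hy hw, ?_⟩
    calc E (m + 1) * (a * E (m + 1) * b) * E (m + 1)
        = (E (m + 1) * a * E (m + 1)) * b * E (m + 1) := by simp only [mul_assoc]
      _ = y * (E (m + 1) * b * E (m + 1)) := by rw [e]; simp only [mul_assoc]
      _ = y * w * E (m + 1) := by rw [e', mul_assoc]

theorem oddProd_mem_gen (k : ℕ) :
    ((List.range k).map (fun i => E (2 * i + 1))).prod ∈ gen F E (2 * k - 1) := by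
  refine Subalgebra.list_prod_mem _ fun a ha => ?_
  obtain ⟨i, hi, rfl⟩ := List.mem_map.1 ha
  have := List.mem_range.1 hi
  exact mem_gen (by omega) (by omega)

theorem exists_oddProd_mul_eq_smul (h : TemperleyLiebRelations δ E L) {k : ℕ}
    (hk : 2 * k - 1 ≤ L) : ∀ x ∈ gen F E (2 * k - 1), ∃ c : F,
      ((List.range k).map (fun i => E (2 * i + 1))).prod * x *
        ((List.range k).map (fun i => E (2 * i + 1))).prod =
      c • ((List.range k).map (fun i => E (2 * i + 1))).prod := by
  induction k with
  | zero =>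
    intro x hx
    obtain ⟨c, rfl⟩ := exists_algebraMap_of_mem_gen_zero hx
    exact ⟨c, by simp [Algebra.algebraMap_eq_smul_one]⟩
  | succ k ih =>
    intro x hx
    obtain ⟨y, hy, e⟩ := h.exists_mul_eq_succ (m := 2 * k) (by omega) hx
    obtain ⟨c, hc⟩ := ih (by omega) y hy
    refine ⟨c, ?_⟩
    have hP : E (2 * k + 1) * ((List.range k).map (fun i => E (2 * i + 1))).prod =
        ((List.range k).map (fun i => E (2 * i + 1))).prod * E (2 * k + 1) := by
      rcases Nat.eq_zero_or_pos k with rfl | hpos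
      · simp
      · exact h.commute_of_mem_gen (by omega) (by omega) (oddProd_mem_gen k)
    rw [List.range_succ, List.map_append, List.prod_append, List.map_singleton,
      List.prod_singleton]
    set P := ((List.range k).map (fun i => E (2 * i + 1))).prod
    calc P * E (2 * k + 1) * x * (P * E (2 * k + 1))
        = P * (E (2 * k + 1) * x * E (2 * k + 1)) * P := by
          simp only [mul_assoc]; rw [hP]
      _ = P * y * P * E (2 * k + 1) := by rw [e]; simp only [mul_assoc]; rw [hP]
      _ = c • (P * E (2 * k + 1)) := by rw [hc, smul_mul_assoc]

end TemperleyLiebRelations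

/-- If `E₁, …, E_{2n−1}` satisfy the Temperley–Lieb relations with parameter `δ` in a
unital associative algebra `A` over a field `F`, and `P = E₁E₃⋯E_{2n−1}` is the product
of the odd-indexed generators, then for every `x` in the subalgebra generated by
`E₁, …, E_{2n−1}` there is a scalar `c` with `P·x·P = c·P`. -/
theorem temperley_lieb_markov_property (F : Type*) [Field F] (A : Type*) [Ring A]
    [Algebra F A] (n : ℕ) (hn : 1 ≤ n) (δ : F) (E : ℕ → A)
    (hsq : ∀ k : ℕ, 1 ≤ k → k ≤ 2 * n - 1 → E k * E k = δ • E k)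
    (hbr : ∀ k : ℕ, 1 ≤ k → k + 1 ≤ 2 * n - 1 →
      E k * E (k + 1) * E k = E k ∧ E (k + 1) * E k * E (k + 1) = E (k + 1))
    (hcomm : ∀ k l : ℕ, 1 ≤ k → k ≤ 2 * n - 1 → 1 ≤ l → l ≤ 2 * n - 1 →
      2 ≤ |(k : ℤ) - (l : ℤ)| → E k * E l = E l * E k) :
    ∀ x ∈ Algebra.adjoin F {a : A | ∃ k : ℕ, 1 ≤ k ∧ k ≤ 2 * n - 1 ∧ a = E k},
      ∃ c : F,
        ((List.range n).map (fun i => E (2 * i + 1))).prod * x *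
          ((List.range n).map (fun i => E (2 * i + 1))).prod =
        c • ((List.range n).map (fun i => E (2 * i + 1))).prod := by
  have h : TemperleyLiebRelations δ E (2 * n - 1) :=
    { sq := hsq
      braid := fun k h1 h2 => (hbr k h1 h2).2
      comm := fun k l h1 h2 h3 => hcomm l k (by omega) h3 h1 (by omega)
        (le_trans (by omega) (le_abs_self _)) }
  exact h.exists_oddProd_mul_eq_smul le_rfl
end

section
/- Let A be a unital associative algebra over ℂ and let G₁, G₂ be invertible elements of A satisfying the braid relation G₁G₂G₁ = G₂G₁G₂. For nonzero x ∈ ℂ set R_i(x) = x·G_i + x⁻¹·G_i⁻¹ (i = 1, 2). Then the parametrized Yang–Baxter equation R₁(x) R₂(xy) R₁(y) = R₂(y) R₁(xy) R₂(x) holds for all nonzero complex x, y if and only if G₁G₂⁻¹G₁ + G₁⁻¹G₂G₁⁻¹ = G₂G₁⁻¹G₂ + G₂⁻¹G₁G₂⁻¹. -/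
/-- Two units satisfying the braid relation intertwine each other. -/
theorem Units.mul_mul_inv_of_braid {M : Type*} [Monoid M] {u v : Mˣ}
    (h : (u : M) * v * u = v * u * v) :
    (u : M) * v * (u⁻¹ : Mˣ) = (v⁻¹ : Mˣ) * u * v := by
  rw [Units.mul_inv_eq_iff_eq_mul, mul_assoc, mul_assoc, Units.eq_inv_mul_iff_mul_eq,
    ← mul_assoc, ← mul_assoc, h]

theorem Units.inv_braid {M : Type*} [Monoid M] {u v : Mˣ}
    (h : (u : M) * v * u = v * u * v) :
    ((u⁻¹ : Mˣ) : M) * (v⁻¹ : Mˣ) * (u⁻¹ : Mˣ) = (v⁻¹ : Mˣ) * (u⁻¹ : Mˣ) * (v⁻¹ : Mˣ) := by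
  have hu : u * v * u = v * u * v := Units.ext h
  have hi : u⁻¹ * v⁻¹ * u⁻¹ = v⁻¹ * u⁻¹ * v⁻¹ := by
    simpa [mul_assoc] using congrArg (·⁻¹) hu
  exact congrArg Units.val hi

theorem Units.inv_mul_inv_mul_of_braid {M : Type*} [Monoid M] {u v : Mˣ}
    (h : (u : M) * v * u = v * u * v) :
    ((u⁻¹ : Mˣ) : M) * (v⁻¹ : Mˣ) * u = v * (u⁻¹ : Mˣ) * (v⁻¹ : Mˣ) := by
  simpa using Units.mul_mul_inv_of_braid (u := u⁻¹) (v := v⁻¹) (Units.inv_braid h)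

/-- The scalar-weighted triple product in the Yang–Baxter equation, expanded by monomials. -/
theorem baxterization_expand {K A : Type*} [Field K] [Ring A] [Algebra K A] (a a' b b' : A)
    {x y : K} (hx : x ≠ 0) (hy : y ≠ 0) :
    (x • a + x⁻¹ • a') * ((x * y) • b + (x * y)⁻¹ • b') * (y • a + y⁻¹ • a') =
      (x ^ 2 * y ^ 2) • (a * b * a) + x ^ 2 • (a * b * a') + y ^ 2 • (a' * b * a) +
        (x ^ 2)⁻¹ • (a' * b' * a) + (y ^ 2)⁻¹ • (a * b' * a') +
        (x ^ 2 * y ^ 2)⁻¹ • (a' * b' * a') + (a * b' * a + a' * b * a') := by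
  simp only [add_mul, mul_add, smul_mul_assoc, mul_smul_comm, smul_add, smul_smul]
  match_scalars <;> field_simp

/-- For invertible `G₁, G₂` satisfying the braid relation, the elements
`R_i(x) = x·G_i + x⁻¹·G_i⁻¹` satisfy the parametrized Yang–Baxter equation
`R₁(x) R₂(xy) R₁(y) = R₂(y) R₁(xy) R₂(x)` for all nonzero `x, y` if and only if
`G₁G₂⁻¹G₁ + G₁⁻¹G₂G₁⁻¹ = G₂G₁⁻¹G₂ + G₂⁻¹G₁G₂⁻¹`. -/
theorem baxterization_criterion (A : Type*) [Ring A] [Algebra ℂ A] (G₁ G₂ : Aˣ)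
    (hbraid : (G₁ : A) * (G₂ : A) * (G₁ : A) = (G₂ : A) * (G₁ : A) * (G₂ : A)) :
    (∀ x y : ℂ, x ≠ 0 → y ≠ 0 →
      (x • (G₁ : A) + x⁻¹ • ((G₁⁻¹ : Aˣ) : A)) *
        ((x * y) • (G₂ : A) + (x * y)⁻¹ • ((G₂⁻¹ : Aˣ) : A)) *
        (y • (G₁ : A) + y⁻¹ • ((G₁⁻¹ : Aˣ) : A)) =
      (y • (G₂ : A) + y⁻¹ • ((G₂⁻¹ : Aˣ) : A)) *
        ((x * y) • (G₁ : A) + (x * y)⁻¹ • ((G₁⁻¹ : Aˣ) : A)) *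
        (x • (G₂ : A) + x⁻¹ • ((G₂⁻¹ : Aˣ) : A))) ↔
    (G₁ : A) * ((G₂⁻¹ : Aˣ) : A) * (G₁ : A) +
        ((G₁⁻¹ : Aˣ) : A) * (G₂ : A) * ((G₁⁻¹ : Aˣ) : A) =
      (G₂ : A) * ((G₁⁻¹ : Aˣ) : A) * (G₂ : A) +
        ((G₂⁻¹ : Aˣ) : A) * (G₁ : A) * ((G₂⁻¹ : Aˣ) : A) := by
  have reduce (x y : ℂ) (hx : x ≠ 0) (hy : y ≠ 0) :
      (x • (G₁ : A) + x⁻¹ • ((G₁⁻¹ : Aˣ) : A)) *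
          ((x * y) • (G₂ : A) + (x * y)⁻¹ • ((G₂⁻¹ : Aˣ) : A)) *
          (y • (G₁ : A) + y⁻¹ • ((G₁⁻¹ : Aˣ) : A)) -
        (y • (G₂ : A) + y⁻¹ • ((G₂⁻¹ : Aˣ) : A)) *
          ((x * y) • (G₁ : A) + (x * y)⁻¹ • ((G₁⁻¹ : Aˣ) : A)) *
          (x • (G₂ : A) + x⁻¹ • ((G₂⁻¹ : Aˣ) : A)) =
      ((G₁ : A) * ((G₂⁻¹ : Aˣ) : A) * (G₁ : A) +
          ((G₁⁻¹ : Aˣ) : A) * (G₂ : A) * ((G₁⁻¹ : Aˣ) : A)) -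
        ((G₂ : A) * ((G₁⁻¹ : Aˣ) : A) * (G₂ : A) +
          ((G₂⁻¹ : Aˣ) : A) * (G₁ : A) * ((G₂⁻¹ : Aˣ) : A)) := by
    rw [baxterization_expand _ _ _ _ hx hy, mul_comm x y, baxterization_expand _ _ _ _ hy hx,
      Units.mul_mul_inv_of_braid hbraid, Units.inv_mul_inv_mul_of_braid hbraid,
      Units.mul_mul_inv_of_braid hbraid.symm, Units.inv_mul_inv_mul_of_braid hbraid.symm,
      hbraid, Units.inv_braid hbraid, mul_comm (y ^ 2)]
    abel
  constructor
  · intro h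
    rw [← sub_eq_zero, ← reduce 1 1 one_ne_zero one_ne_zero, sub_eq_zero]
    exact h 1 1 one_ne_zero one_ne_zero
  · intro h x y hx hy
    rw [← sub_eq_zero, reduce x y hx hy, sub_eq_zero]
    exact h
end

section
/- Let H be a complex Hilbert space, let τ be a real number, and suppose (e_n)_{n ∈ ℕ} is a sequence of nonzero bounded operators on H such that each e_n is an orthogonal projection (e_n = e_n* = e_n²), e_n e_{n+1} e_n = τ·e_n and e_{n+1} e_n e_{n+1} = τ·e_{n+1} for all n, and e_m e_n = e_n e_m whenever |m−n| ≥ 2. Then either τ ≤ 1/4, or there exists an integer n ≥ 3 such that 1/τ = 4·cos²(π/n). -/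
/-- The Jones–Wenzl recursion `f₀ = 1`, `fₙ₊₁ = fₙ - cₙ • fₙ eₙ fₙ`. -/
def jonesWenzl {K A : Type*} [Field K] [Ring A] [Algebra K A] (e : ℕ → A) (c : ℕ → K) : ℕ → A
  | 0 => 1
  | n + 1 => jonesWenzl e c n - c n • (jonesWenzl e c n * e n * jonesWenzl e c n)

section Algebra

variable {K A : Type*} [Field K] [Ring A] [Algebra K A] {e : ℕ → A}

lemma jonesWenzl_commute {c : ℕ → K} (hcomm : ∀ m n, m + 2 ≤ n → Commute (e m) (e n)) (n : ℕ) :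
    ∀ m, n + 1 ≤ m → Commute (jonesWenzl e c n) (e m) := by
  induction n with
  | zero => exact fun m _ => Commute.one_left _
  | succ n ih =>
    intro m hm
    have h := ih m (by omega)
    exact h.sub_left (((h.mul_left (hcomm n m (by omega))).mul_left h).smul_left _)

/-- Wenzl's relations for the Jones–Wenzl elements, as long as no denominator vanishes. -/
lemma jonesWenzl_relations {τ : K} {p : ℕ → K} (hidem : ∀ n, e n * e n = e n)
    (hrel : ∀ n, e (n + 1) * e n * e (n + 1) = τ • e (n + 1))
    (hcomm : ∀ m n, m + 2 ≤ n → Commute (e m) (e n))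
    (hp : ∀ n, p (n + 2) = p (n + 1) - τ * p n) (hp₀ : p 0 = 0) {c : ℕ → K}
    (hc : ∀ n, c n = p (n + 1) / p (n + 2)) (n : ℕ) (hn : ∀ j, 1 ≤ j → j ≤ n + 1 → p j ≠ 0) :
    jonesWenzl e c n * jonesWenzl e c n = jonesWenzl e c n ∧
    jonesWenzl e c (n - 1) * jonesWenzl e c n = jonesWenzl e c n ∧
    e n * jonesWenzl e c n * e n = (p (n + 2) / p (n + 1)) • (e n * jonesWenzl e c (n - 1)) := by
  induction n with
  | zero =>
    have h1 : p 1 ≠ 0 := hn 1 le_rfl le_rfl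
    have h2 : p 2 = p 1 := by simpa [hp₀] using hp 0
    simp [jonesWenzl, hidem, h1, h2]
  | succ n ih =>
    obtain ⟨hff, hgf, hefe⟩ := ih fun j h1 h2 => hn j h1 (by omega)
    have h1 : p (n + 1) ≠ 0 := hn _ (by omega) (by omega)
    have h2 : p (n + 2) ≠ 0 := hn _ (by omega) (by omega)
    have hfe : Commute (jonesWenzl e c n) (e (n + 1)) := jonesWenzl_commute hcomm n _ le_rfl
    have hcn := hc n
    rw [Nat.add_sub_cancel]
    simp only [jonesWenzl]
    set f := jonesWenzl e c n
    set g := jonesWenzl e c (n - 1)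
    have hfefef : f * e n * f * (f * e n * f) = (p (n + 2) / p (n + 1)) • (f * e n * f) := by
      calc f * e n * f * (f * e n * f) = f * (e n * (f * f) * e n) * f := by noncomm_ring
        _ = (p (n + 2) / p (n + 1)) • (f * e n * (g * f)) := by
          rw [hff, hefe]; simp only [mul_smul_comm, smul_mul_assoc, mul_assoc]
        _ = _ := by rw [hgf]
    have hl : f * (f * e n * f) = f * e n * f := by rw [← mul_assoc, ← mul_assoc, hff]
    have hr : f * e n * f * f = f * e n * f := by rw [mul_assoc, hff]
    refine ⟨?_, ?_, ?_⟩
    · have hcc : c n * (p (n + 2) / p (n + 1)) = 1 := by rw [hcn]; field_simp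
      rw [sub_mul, mul_sub, mul_sub, mul_smul_comm, smul_mul_assoc, smul_mul_assoc, mul_smul_comm,
        hfefef, hl, hr, hff, smul_smul (c n) (p (n + 2) / _), hcc, one_smul]
      abel
    · rw [mul_sub, mul_smul_comm, hl, hff]
    · have hx : e (n + 1) * (f * e n * f) * e (n + 1) = τ • (e (n + 1) * f) := by
        calc e (n + 1) * (f * e n * f) * e (n + 1)
            = (e (n + 1) * f) * e n * (f * e (n + 1)) := by noncomm_ring
          _ = f * (e (n + 1) * e n * e (n + 1)) * f := by
            rw [← hfe.eq, hfe.eq]; nth_rw 1 [← hfe.eq]; noncomm_ring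
          _ = _ := by
            rw [hrel, mul_smul_comm, smul_mul_assoc, hfe.eq, mul_assoc, hff]
      have hy : e (n + 1) * f * e (n + 1) = e (n + 1) * f := by
        rw [mul_assoc, hfe.eq, ← mul_assoc, hidem]
      rw [mul_sub, sub_mul, mul_smul_comm, smul_mul_assoc, hx, hy, smul_smul, hcn, hp (n + 1)]
      rw [show (p (n + 1 + 1) - τ * p (n + 1)) / p (n + 1 + 1)
        = 1 - p (n + 1) / p (n + 2) * τ by field_simp, sub_smul, one_smul]

lemma isSelfAdjoint_jonesWenzl [StarRing K] [StarRing A] [StarModule K A] {c : ℕ → K}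
    (he : ∀ n, IsSelfAdjoint (e n)) (hc : ∀ n, IsSelfAdjoint (c n)) (n : ℕ) :
    IsSelfAdjoint (jonesWenzl e c n) := by
  induction n with
  | zero => exact IsSelfAdjoint.one A
  | succ n ih =>
    refine ih.sub ((hc n).smul ?_)
    simpa only [ih.star_eq] using (he n).conjugate (jonesWenzl e c n)

lemma mul_eq_zero_of_relation {τ : K} (hτ : τ ≠ 0) {a b q : A} (h : a * b * a = τ • a)
    (hq : Commute q a) (hz : b * q = 0) : a * q = 0 := by
  have : τ • (a * q) = 0 := by
    rw [← smul_mul_assoc, ← h, mul_assoc, ← hq.eq, mul_assoc, ← mul_assoc b, hz]; simp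
  exact (smul_eq_zero.mp this).resolve_left hτ

/-- If `q` commutes with `e m` for `m ≥ s` and `e s * q = 0`, then `e m * q = 0` for `m ≥ s`. -/
lemma mul_eq_zero_of_le {τ : K} (hτ : τ ≠ 0)
    (hrel : ∀ n, e (n + 1) * e n * e (n + 1) = τ • e (n + 1)) {q : A} {s t : ℕ}
    (hq : ∀ m, s ≤ m → m ≤ t → Commute q (e m)) (hz : e s * q = 0) :
    ∀ m, s ≤ m → m ≤ t → e m * q = 0 := by
  intro m hm
  induction m, hm using Nat.le_induction with
  | base => exact fun _ => hz
  | succ m hm ih =>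
    exact fun ht => mul_eq_zero_of_relation hτ (hrel m) (hq _ (by omega) ht) (ih (by omega))

lemma mul_mul_eq_zero_of_le {τ : K} (hτ : τ ≠ 0)
    (hrel : ∀ n, e (n + 1) * e n * e (n + 1) = τ • e (n + 1))
    (hcomm : ∀ m n, m + 2 ≤ n → Commute (e m) (e n)) {q : A} {s : ℕ}
    (hq : ∀ m, s ≤ m → Commute q (e m)) (hz : e s * e (s + 2) * q = 0) {m n : ℕ} (hm : s ≤ m)
    (hmn : m + 2 ≤ n) : e m * e n * q = 0 := by
  have h1 : e n * (e s * q) = 0 := by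
    refine mul_eq_zero_of_le (t := n) hτ hrel (fun j hj _ => ?_) ?_ n (by omega) le_rfl (s := s + 2)
    · exact (hcomm s j hj).mul_left (hq j (by omega))
    · rw [← mul_assoc, ← (hcomm s (s + 2) le_rfl).eq, hz]
  rw [mul_assoc]
  refine mul_eq_zero_of_le (t := m) hτ hrel (fun j hj hjm => ?_) ?_ m hm le_rfl (s := s)
  · exact (hcomm j n (by omega)).symm.mul_left (hq j hj)
  · rw [← mul_assoc, (hcomm s n (by omega)).eq, mul_assoc, h1]

end Algebra

section Hilbert

variable {H : Type*} [NormedAddCommGroup H] [InnerProductSpace ℂ H]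

/-- Vectors of constant norm, with consecutive inner products less than `-1/2` times the squared
norm and all others zero, must vanish. -/
lemma eq_zero_of_tridiagonal_gram {t : ℕ → H} {a r : ℝ} (hr : 1 / 2 < r)
    (hnorm : ∀ n, ‖t n‖ ^ 2 = a) (hnext : ∀ n, inner ℂ (t n) (t (n + 1)) = ((-(r * a) : ℝ) : ℂ))
    (hfar : ∀ m n, m + 2 ≤ n → inner ℂ (t m) (t n) = 0) : t 0 = 0 := by
  have hsum (N : ℕ) :
      ‖∑ i ∈ Finset.range (N + 1), t i‖ ^ 2 = a + N * (a * (1 - 2 * r)) := by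
    induction N with
    | zero => simp [hnorm]
    | succ N ih =>
      have hin : inner ℂ (∑ i ∈ Finset.range (N + 1), t i) (t (N + 1)) = ((-(r * a) : ℝ) : ℂ) := by
        rw [sum_inner, Finset.sum_range_succ, hnext, Finset.sum_eq_zero, zero_add]
        intro i hi
        exact hfar i _ (by have := Finset.mem_range.mp hi; omega)
      rw [Finset.sum_range_succ, norm_add_sq (𝕜 := ℂ), ih, hin, hnorm, RCLike.re_to_complex,
        Complex.ofReal_re]
      push_cast
      ring
  have ha : a ≤ 0 := by
    by_contra! ha
    obtain ⟨N, hN⟩ := exists_nat_gt (a / (a * (2 * r - 1)))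
    rw [div_lt_iff₀ (mul_pos ha (by linarith))] at hN
    have h := hsum N
    have := sq_nonneg ‖∑ i ∈ Finset.range (N + 1), t i‖
    nlinarith
  have h0 : ‖t 0‖ ^ 2 = 0 := le_antisymm (hnorm 0 ▸ ha) (sq_nonneg _)
  simpa using h0

variable [CompleteSpace H]

lemma norm_sq_eq_inner_of_isSelfAdjoint {p : H →L[ℂ] H} (hp : IsSelfAdjoint p)
    (hidem : p * p = p) (x : H) : inner ℂ x (p x) = ((‖p x‖ ^ 2 : ℝ) : ℂ) := by
  have h : p (p x) = p x := congr($hidem x)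
  rw [← h, ← ContinuousLinearMap.adjoint_inner_left, ← ContinuousLinearMap.star_eq_adjoint,
    hp.star_eq, h, inner_self_eq_norm_sq_to_K]
  norm_cast

variable {τ : ℝ} {e : ℕ → H →L[ℂ] H}

/-- For `τ > 1/4`, an operator commuting with a tail of the sequence which is not killed by one
projection is not killed by two commuting ones. -/
lemma mul_eq_zero_of_mul_mul_eq_zero (hτ : 1 / 4 < τ) (hsa : ∀ n, IsSelfAdjoint (e n))
    (hidem : ∀ n, e n * e n = e n) (hrel₁ : ∀ n, e n * e (n + 1) * e n = (τ : ℂ) • e n)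
    (hrel₂ : ∀ n, e (n + 1) * e n * e (n + 1) = (τ : ℂ) • e (n + 1))
    (hcomm : ∀ m n, m + 2 ≤ n → Commute (e m) (e n)) {q : H →L[ℂ] H} {s : ℕ}
    (hq : ∀ m, s ≤ m → Commute q (e m)) (hz : e s * e (s + 2) * q = 0) : e s * q = 0 := by
  have hτ₀ : (τ : ℂ) ≠ 0 := by
    have : τ ≠ 0 := by linarith
    exact_mod_cast this
  set r := √τ
  have hrr : r * r = τ := Real.mul_self_sqrt (by linarith)
  have hr : 1 / 2 < r := Real.lt_sqrt_of_sq_lt (by linarith)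
  have hrne : r ≠ 0 := by linarith
  ext y
  let w : ℕ → H := fun n => Nat.rec (e s y) (fun n x => ((-r⁻¹ : ℝ) : ℂ) • e (s + n + 1) x) n
  have hw (n : ℕ) : w (n + 1) = ((-r⁻¹ : ℝ) : ℂ) • e (s + n + 1) (w n) := rfl
  have hew (n : ℕ) : e (s + n) (w n) = w n := by
    cases n with
    | zero => exact congr($(hidem s) y)
    | succ n =>
      rw [hw, map_smul]
      exact congr(_ • $(hidem (s + n + 1)) (w n))
  have hqe (m : ℕ) (hm : s ≤ m) (x : H) : e m (q x) = q (e m x) := congr($((hq m hm).eq) x).symm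
  have hfix (n : ℕ) : e (s + n) (q (w n)) = q (w n) := by rw [hqe _ (by omega), hew]
  have hadj (n : ℕ) (x z : H) : inner ℂ (e n x) z = inner ℂ x (e n z) := by
    rw [← ContinuousLinearMap.adjoint_inner_right, ← ContinuousLinearMap.star_eq_adjoint,
      (hsa n).star_eq]
  have hstep (n : ℕ) : ‖e (s + n + 1) (q (w n))‖ ^ 2 = τ * ‖q (w n)‖ ^ 2 := by
    have h := norm_sq_eq_inner_of_isSelfAdjoint (hsa (s + n + 1)) (hidem _) (q (w n))
    have h' : e (s + n) (e (s + n + 1) (e (s + n) (q (w n)))) = (τ : ℂ) • e (s + n) (q (w n)) :=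
      congr($(hrel₁ (s + n)) (q (w n)))
    rw [hfix] at h'
    nth_rw 1 [← hfix n] at h
    rw [hadj, h', inner_smul_right, inner_self_eq_norm_sq_to_K] at h
    exact Complex.ofReal_injective (by rw [← h]; push_cast; rfl)
  have hqw (n : ℕ) : q (w (n + 1)) = ((-r⁻¹ : ℝ) : ℂ) • e (s + n + 1) (q (w n)) := by
    rw [hw, map_smul, hqe _ (by omega)]
  have hnorm (n : ℕ) : ‖q (w n)‖ ^ 2 = ‖q (w 0)‖ ^ 2 := by
    induction n with
    | zero => rfl
    | succ n ih =>
      rw [hqw, norm_smul, mul_pow, hstep, ih, Complex.norm_real, Real.norm_eq_abs, sq_abs, ← hrr]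
      field_simp
  have h0 : q (w 0) = 0 := by
    refine eq_zero_of_tridiagonal_gram (t := fun n => q (w n)) hr hnorm (fun n => ?_)
      (fun m n hmn => ?_)
    · rw [hqw, inner_smul_right, norm_sq_eq_inner_of_isSelfAdjoint (hsa _) (hidem _), hstep, hnorm,
        ← Complex.ofReal_mul, ← hrr]
      congr 1
      field_simp
    · have h := mul_mul_eq_zero_of_le hτ₀ hrel₂ hcomm hq hz (m := s + m) (n := s + n) (by omega)
        (by omega)
      have h' : e (s + m) (e (s + n) (q (w n))) = 0 := congr($h (w n))
      rw [hfix] at h'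
      rw [← hfix m, hadj, h', inner_zero_right]
  have : e s (q y) = q (w 0) := hqe s le_rfl y
  simpa [h0] using this

/-- A positive solution of the Temperley–Lieb recursion cannot become negative. -/
lemma nonneg_of_recursion (hτ : 1 / 4 < τ) (hne : ∀ n, e n ≠ 0) (hsa : ∀ n, IsSelfAdjoint (e n))
    (hidem : ∀ n, e n * e n = e n) (hrel₁ : ∀ n, e n * e (n + 1) * e n = (τ : ℂ) • e n)
    (hrel₂ : ∀ n, e (n + 1) * e n * e (n + 1) = (τ : ℂ) • e (n + 1))
    (hcomm : ∀ m n, m + 2 ≤ n → Commute (e m) (e n)) {p : ℕ → ℝ}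
    (hp : ∀ n, p (n + 2) = p (n + 1) - τ * p n) (hp₀ : p 0 = 0) {n : ℕ}
    (hpos : ∀ j, 1 ≤ j → j ≤ n + 2 → 0 < p j) : 0 ≤ p (n + 3) := by
  have hτ₀ : (τ : ℂ) ≠ 0 := by
    have : τ ≠ 0 := by linarith
    exact_mod_cast this
  set c : ℕ → ℂ := fun n => (p (n + 1) : ℂ) / (p (n + 2) : ℂ) with hc
  set f := jonesWenzl e c
  have hfe (k : ℕ) : ∀ m, k + 1 ≤ m → Commute (f k) (e m) := jonesWenzl_commute hcomm k
  have hsf (k : ℕ) : IsSelfAdjoint (f k) := isSelfAdjoint_jonesWenzl hsa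
    (fun n => by simp [IsSelfAdjoint, hc]) k
  have hrels (k : ℕ) (hk : k ≤ n + 1) := jonesWenzl_relations (τ := (τ : ℂ))
    (p := fun n => (p n : ℂ)) hidem hrel₂ hcomm (fun n => by rw [hp]; push_cast; ring)
    (by simp [hp₀]) (c := c) (fun _ => rfl) k
    (fun j h1 h2 => by exact_mod_cast (hpos j h1 (by omega)).ne')
  have hnz (k : ℕ) (hk : k ≤ n) : e (k + 1) * f k ≠ 0 := by
    induction k with
    | zero => simpa [f, jonesWenzl] using hne 1
    | succ k ih =>
      intro h
      refine ih (by omega) (mul_eq_zero_of_mul_mul_eq_zero hτ hsa hidem hrel₁ hrel₂ hcomm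
        (hfe k) ?_)
      have h3 : e (k + 3) * f (k + 1) = 0 := mul_eq_zero_of_le (t := k + 3) hτ₀ hrel₂
        (fun m hm _ => hfe (k + 1) m (by omega)) h (k + 3) (by omega) le_rfl
      have hr := (hrels (k + 1) (by omega)).2.2
      have hcm := hcomm (k + 1) (k + 3) le_rfl
      have h4 : e (k + 3) * (e (k + 1) * f (k + 1) * e (k + 1)) = 0 := by
        rw [← mul_assoc, ← mul_assoc, ← hcm.eq, mul_assoc (e (k + 1)), h3]; simp
      have h5 : (p (k + 3) : ℂ) / p (k + 2) ≠ 0 := by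
        have h6 := (hpos (k + 3) (by omega) (by omega)).ne'
        have h7 := (hpos (k + 2) (by omega) (by omega)).ne'
        exact_mod_cast div_ne_zero h6 h7
      rw [hr, mul_smul_comm, ← mul_assoc, ← hcm.eq] at h4
      exact (smul_eq_zero.mp h4).resolve_left h5
  have hb_sa : IsSelfAdjoint (e (n + 1) * f n) := by
    rw [IsSelfAdjoint, star_mul, (hsa _).star_eq, (hsf _).star_eq, (hfe n _ le_rfl).eq]
  have hb_idem : e (n + 1) * f n * (e (n + 1) * f n) = e (n + 1) * f n := by
    rw [mul_assoc, ← mul_assoc (f n), (hfe n _ le_rfl).eq, mul_assoc, (hrels n (by omega)).1,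
      ← mul_assoc, hidem]
  obtain ⟨x, hx⟩ : ∃ x, (e (n + 1) * f n) x ≠ 0 := by
    by_contra! h
    exact hnz n le_rfl (ContinuousLinearMap.ext h)
  have hr : e (n + 1) (f (n + 1) (e (n + 1) x))
      = ((p (n + 3) : ℂ) / p (n + 2)) • (e (n + 1) * f n) x :=
    congr($((hrels (n + 1) le_rfl).2.2) x)
  have hi := norm_sq_eq_inner_of_isSelfAdjoint (hsf (n + 1)) (hrels (n + 1) le_rfl).1 (e (n + 1) x)
  rw [← ContinuousLinearMap.adjoint_inner_right, ← ContinuousLinearMap.star_eq_adjoint,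
    (hsa _).star_eq, hr, inner_smul_right,
    norm_sq_eq_inner_of_isSelfAdjoint hb_sa hb_idem] at hi
  have hi' : p (n + 3) / p (n + 2) * ‖(e (n + 1) * f n) x‖ ^ 2
      = ‖f (n + 1) (e (n + 1) x)‖ ^ 2 := by exact_mod_cast hi
  have h2 := hpos (n + 2) (by omega) le_rfl
  by_contra! hlt
  have h3 : 0 < ‖(e (n + 1) * f n) x‖ ^ 2 := by positivity
  have h4 := mul_neg_of_neg_of_pos (div_neg_of_neg_of_pos hlt h2) h3
  have := sq_nonneg ‖f (n + 1) (e (n + 1) x)‖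
  linarith

end Hilbert


/-- Restriction on the Temperley–Lieb parameter: if a sequence of nonzero orthogonal
projections `(e_n)` on a complex Hilbert space satisfies `e_n e_{n±1} e_n = τ·e_n` and
distant projections commute, then either `τ ≤ 1/4` or `1/τ = 4·cos²(π/n)` for some
integer `n ≥ 3`. -/
theorem temperley_lieb_index_restriction (H : Type*) [NormedAddCommGroup H]
    [InnerProductSpace ℂ H] [CompleteSpace H] (τ : ℝ) (e : ℕ → H →L[ℂ] H)
    (hne : ∀ n, e n ≠ 0)
    (hproj : ∀ n, ContinuousLinearMap.adjoint (e n) = e n ∧ e n * e n = e n)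
    (hrel₁ : ∀ n, e n * e (n + 1) * e n = (τ : ℂ) • e n)
    (hrel₂ : ∀ n, e (n + 1) * e n * e (n + 1) = (τ : ℂ) • e (n + 1))
    (hcomm : ∀ m n : ℕ, 2 ≤ |(m : ℤ) - (n : ℤ)| → e m * e n = e n * e m) :
    τ ≤ 1 / 4 ∨ ∃ n : ℕ, 3 ≤ n ∧ 1 / τ = 4 * Real.cos (Real.pi / n) ^ 2 := by
  rw [or_iff_not_imp_left, not_le]
  intro hτ
  have hcomm' (m n : ℕ) (h : m + 2 ≤ n) : Commute (e m) (e n) :=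
    hcomm m n (by rw [abs_sub_comm]; exact le_trans (by omega) (le_abs_self _))
  set r := √τ
  have hrr : r * r = τ := Real.mul_self_sqrt (by linarith)
  have hr : 1 / 2 < r := Real.lt_sqrt_of_sq_lt (by linarith)
  have hr₀ : 0 < r := by linarith
  set θ := Real.arccos (1 / (2 * r))
  have hlt : 1 / (2 * r) < 1 := by rw [div_lt_one (by positivity)]; linarith
  have hcos : Real.cos θ = 1 / (2 * r) :=
    Real.cos_arccos (by have : 0 < 1 / (2 * r) := by positivity
                        linarith) hlt.le
  have hθ₀ : 0 < θ := Real.arccos_pos.mpr hlt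
  have hθ₁ : θ < Real.pi / 2 := Real.arccos_lt_pi_div_two.mpr (by positivity)
  have hex : ∃ k : ℕ, Real.pi ≤ k * θ := by
    obtain ⟨k, hk⟩ := exists_nat_ge (Real.pi / θ)
    exact ⟨k, (div_le_iff₀ hθ₀).mp hk⟩
  classical
  obtain ⟨k, hk, hmin⟩ : ∃ k : ℕ, Real.pi ≤ k * θ ∧ ∀ j < k, (j : ℝ) * θ < Real.pi :=
    ⟨Nat.find hex, Nat.find_spec hex, fun j hj => not_le.mp (Nat.find_min hex hj)⟩
  have hk3 : 3 ≤ k := by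
    by_contra! h
    have : (k : ℝ) ≤ 2 := by exact_mod_cast Nat.le_of_lt_succ h
    nlinarith
  refine ⟨k, hk3, ?_⟩
  have hkπ : k * θ = Real.pi := by
    refine le_antisymm ?_ hk
    by_contra! hgt
    obtain ⟨n, rfl⟩ := Nat.exists_eq_add_of_le' hk3
    have hrec := nonneg_of_recursion (p := fun n => r ^ n * Real.sin (n * θ)) (n := n) hτ hne
      (fun n => (hproj n).1) (fun n => (hproj n).2) hrel₁ hrel₂ hcomm' (fun n => by
        have h1 : ((n + 2 : ℕ) : ℝ) * θ = (n + 1 : ℕ) * θ + θ := by push_cast; ring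
        have h2 : (n : ℝ) * θ = (n + 1 : ℕ) * θ - θ := by push_cast; ring
        have h3 : 2 * r * Real.cos θ = 1 := by rw [hcos]; field_simp
        rw [h1, h2, Real.sin_add, Real.sin_sub, ← hrr]
        linear_combination r ^ (n + 1) * Real.sin ((n + 1 : ℕ) * θ) * h3) (by simp)
      (fun j h1 h2 => by
        have : (0 : ℝ) < j := by exact_mod_cast h1
        exact mul_pos (by positivity)
          (Real.sin_pos_of_pos_of_lt_pi (by positivity) (hmin j (by omega))))
    have h1 := hmin (n + 2) (by omega)
    have h2 : ((n + 3 : ℕ) : ℝ) * θ = (n + 2 : ℕ) * θ + θ := by push_cast; ring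
    have h3 : Real.sin ((n + 3 : ℕ) * θ) < 0 := by
      rw [← Real.sin_sub_two_pi]
      exact Real.sin_neg_of_neg_of_neg_pi_lt (by linarith) (by linarith)
    have := mul_neg_of_pos_of_neg (pow_pos hr₀ (n + 3)) h3
    linarith
  have hk₀ : (k : ℝ) ≠ 0 := by positivity
  rw [← hkπ, mul_div_cancel_left₀ _ hk₀, hcos, ← hrr]
  field_simp
  norm_num
end

section
/- Let n ≥ 2 and for 1 ≤ i ≤ n−1 let S_{i,i+1} be the operator on (ℂ²)^{⊗n} that swaps tensor factors i and i+1. Then the operators F_i := 1 − S_{i,i+1} satisfy the Temperley–Lieb relations with parameter δ = 2 (i.e. the parameter value corresponding to Q = 4): F_i² = 2·F_i, F_i F_{i±1} F_i = F_i, and F_i F_j = F_j F_i whenever |i−j| ≥ 2. -/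
open Matrix

/-- The operator `S_{i,i+1}` on `(ℂ²)^{⊗n}` swapping the (0-based) tensor factors `s` and
`s + 1`, as a matrix indexed by functions `Fin n → Fin 2`:
`(S) x y = 1` if `y` is obtained from `x` by exchanging the values at `s` and `s + 1`,
and `0` otherwise. -/
noncomputable def swapOp (n : ℕ) (s : ℕ) :
    Matrix (Fin n → Fin 2) (Fin n → Fin 2) ℂ :=
  Matrix.of fun x y =>
    if h : s + 1 < n then
      if y = x ∘ Equiv.swap (⟨s, by omega⟩ : Fin n) ⟨s + 1, h⟩ then 1 else 0
    else 0

/-- `F_i := 1 − S_{i,i+1}` (`i` 1-based, acting on factors `i` and `i + 1`). -/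
noncomputable def symF (n : ℕ) (i : ℕ) :
    Matrix (Fin n → Fin 2) (Fin n → Fin 2) ℂ :=
  1 - swapOp n (i - 1)

theorem comp_swap_eq_self {ι α : Type*} [DecidableEq ι] {x : ι → α} {i j : ι} (h : x i = x j) :
    x ∘ Equiv.swap i j = x := by
  ext k
  simp only [Function.comp_apply, Equiv.swap_apply_def]
  split_ifs <;> simp_all

theorem swap_braid {ι : Type*} [DecidableEq ι] {i j k : ι} (hij : i ≠ j) (hik : i ≠ k)
    (hjk : j ≠ k) :
    Equiv.swap i j * Equiv.swap j k * Equiv.swap i j =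
      Equiv.swap j k * Equiv.swap i j * Equiv.swap j k := by
  rw [Equiv.swap_mul_swap_mul_swap hij hik, Equiv.swap_comm i j, Equiv.swap_comm j k,
    Equiv.swap_mul_swap_mul_swap hjk.symm hik.symm, Equiv.swap_comm]

/-- The operator on functions `ι → Fin 2` that precomposes with the permutation `σ`. -/
def precompOp {ι : Type*} [Fintype ι] (σ : Equiv.Perm ι) :
    Matrix (ι → Fin 2) (ι → Fin 2) ℂ :=
  Matrix.of fun x y => if y = x ∘ σ then 1 else 0

theorem precompOp_apply {ι : Type*} [Fintype ι] (σ : Equiv.Perm ι) (x y : ι → Fin 2) :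
    precompOp σ x y = if y = x ∘ σ then 1 else 0 := rfl

theorem precompOp_one {ι : Type*} [Fintype ι] : precompOp (1 : Equiv.Perm ι) = 1 := by
  ext x y
  simp [precompOp_apply, Matrix.one_apply, eq_comm]

theorem precompOp_mul {ι : Type*} [Fintype ι] [DecidableEq ι] (σ τ : Equiv.Perm ι) :
    precompOp (σ * τ) = precompOp σ * precompOp τ := by
  ext x y
  simp only [precompOp_apply, Matrix.mul_apply, ite_mul, one_mul, zero_mul,
    Finset.sum_ite_eq', Finset.mem_univ, if_true]
  rfl

theorem precompOp_swap_mul_self {ι : Type*} [Fintype ι] [DecidableEq ι] (i j : ι) :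
    precompOp (Equiv.swap i j) * precompOp (Equiv.swap i j) = 1 := by
  rw [← precompOp_mul, Equiv.swap_mul_self, precompOp_one]

/-- The antisymmetrizer on three tensor factors of dimension two vanishes. -/
theorem precompOp_antisymmetrizer {ι : Type*} [Fintype ι] [DecidableEq ι] {i j k : ι}
    (hij : i ≠ j) (hik : i ≠ k) (hjk : j ≠ k) :
    1 - precompOp (Equiv.swap i j) - precompOp (Equiv.swap j k) +
      precompOp (Equiv.swap i j) * precompOp (Equiv.swap j k) +
      precompOp (Equiv.swap j k) * precompOp (Equiv.swap i j) -
      precompOp (Equiv.swap i j) * precompOp (Equiv.swap j k) * precompOp (Equiv.swap i j) =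
      0 := by
  have hb := swap_braid hij hik hjk
  have hc := Equiv.swap_mul_swap_mul_swap hjk.symm hik.symm
  rw [Equiv.swap_comm k j, Equiv.swap_comm j i] at hc
  have ha2 := Equiv.swap_mul_self i j
  have hb2 := Equiv.swap_mul_self j k
  simp only [← precompOp_mul, ← precompOp_one (ι := ι)]
  ext x y
  have hx : x i = x j ∨ x j = x k ∨ x i = x k := by omega
  have hcomp (σ τ : Equiv.Perm ι) : x ∘ (σ * τ : Equiv.Perm ι) = (x ∘ σ) ∘ τ := rfl
  have h1 : x ∘ (1 : Equiv.Perm ι) = x := rfl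
  simp only [Matrix.add_apply, Matrix.sub_apply, Matrix.zero_apply, precompOp_apply]
  rcases hx with h | h | h
  · have h := comp_swap_eq_self h
    simp only [hcomp, h, h1]
    ring
  · have h := comp_swap_eq_self h
    rw [hb]
    simp only [hcomp, h, h1]
    ring
  · have h := comp_swap_eq_self h
    have hab : Equiv.swap i j * Equiv.swap j k = Equiv.swap i k * Equiv.swap i j := by
      rw [← hc, mul_assoc, ha2, mul_one]
    have hba : Equiv.swap j k * Equiv.swap i j = Equiv.swap i k * Equiv.swap j k := by
      rw [← hc, hb, mul_assoc, hb2, mul_one]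
    rw [hc, hab, hba]
    simp only [hcomp, h, h1]
    ring

theorem symF_eq {n i : ℕ} (h : i - 1 + 1 < n) :
    symF n i = 1 - precompOp (Equiv.swap (⟨i - 1, by omega⟩ : Fin n) ⟨i - 1 + 1, h⟩) := by
  ext x y
  simp only [symF, swapOp, precompOp_apply, Matrix.sub_apply, Matrix.of_apply, dif_pos h]

theorem one_sub_mul_one_sub_mul_one_sub {R : Type*} [Ring R] {a b : R} (ha : a * a = 1)
    (h : 1 - a - b + a * b + b * a - a * b * a = 0) :
    (1 - a) * (1 - b) * (1 - a) = 1 - a := by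
  have expand : (1 - a) * (1 - b) * (1 - a) =
      (1 - a) + (1 - a - b + a * b + b * a - a * b * a) + (a * a - 1) := by noncomm_ring
  rw [expand, h, ha, sub_self, add_zero, add_zero]

/-- The operators `F_i = 1 − S_{i,i+1}` satisfy the Temperley–Lieb relations with
parameter `δ = 2` (the value corresponding to `Q = 4`). -/
theorem symF_temperley_lieb (n : ℕ) (hn : 2 ≤ n) :
    (∀ i : ℕ, 1 ≤ i → i ≤ n - 1 → symF n i * symF n i = (2 : ℂ) • symF n i) ∧
    (∀ i : ℕ, 1 ≤ i → i + 1 ≤ n - 1 →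
      symF n i * symF n (i + 1) * symF n i = symF n i ∧
      symF n (i + 1) * symF n i * symF n (i + 1) = symF n (i + 1)) ∧
    (∀ i j : ℕ, 1 ≤ i → i ≤ n - 1 → 1 ≤ j → j ≤ n - 1 →
      2 ≤ |(i : ℤ) - (j : ℤ)| →
      symF n i * symF n j = symF n j * symF n i) := by
  refine ⟨fun i hi hin => ?_, fun i hi hin => ?_, fun i j hi hin hj hjn hij => ?_⟩
  · rw [symF_eq (show i - 1 + 1 < n by omega)]
    simp only [sub_mul, mul_sub, one_mul, mul_one, precompOp_swap_mul_self, two_smul]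
    abel
  · obtain ⟨i, rfl⟩ : ∃ m, i = m + 1 := ⟨i - 1, by omega⟩
    rw [symF_eq (show i + 1 - 1 + 1 < n by omega),
      symF_eq (show i + 1 + 1 - 1 + 1 < n by omega)]
    simp only [Nat.add_sub_cancel]
    have hij : (⟨i, by omega⟩ : Fin n) ≠ ⟨i + 1, by omega⟩ := by simp
    have hik : (⟨i, by omega⟩ : Fin n) ≠ ⟨i + 1 + 1, by omega⟩ := by
      simp only [ne_eq, Fin.mk.injEq]; omega
    have hjk : (⟨i + 1, by omega⟩ : Fin n) ≠ ⟨i + 1 + 1, by omega⟩ := by simp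
    have hanti := precompOp_antisymmetrizer hij hik hjk
    refine ⟨one_sub_mul_one_sub_mul_one_sub (precompOp_swap_mul_self _ _) hanti,
      one_sub_mul_one_sub_mul_one_sub (precompOp_swap_mul_self _ _) ?_⟩
    simp only [← precompOp_mul] at hanti ⊢
    rw [← hanti, swap_braid hij hik hjk]
    abel
  · rw [symF_eq (show i - 1 + 1 < n by omega), symF_eq (show j - 1 + 1 < n by omega)]
    have hdisj : i + 2 ≤ j ∨ j + 2 ≤ i := by
      rcases le_abs.mp hij with h | h <;> omega
    refine Commute.sub_right (Commute.one_right _) (Commute.sub_left (Commute.one_left _) ?_)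
    rw [commute_iff_eq, ← precompOp_mul, ← precompOp_mul]
    congr 1
    refine (Equiv.Perm.disjoint_swap_swap ?_).commute.eq
    simp only [List.nodup_cons, List.mem_cons, Fin.mk.injEq, List.not_mem_nil, List.nodup_nil,
      not_false_eq_true, and_true, or_false]
    omega
end
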